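/- (Finite determination with nonlinear constraints.) Suppose A^k → 0 as k → ∞ (equivalently, A is Schur stable), Ω is compact with the origin in its interior, the two-sided quadratic bounds of Assumption Q hold for all x ∈ ℝ^n, and Q_1 = (1/D_x) I_n with q_1 = 0 for some D_x > 0. Then there exists a finite k* ∈ ℕ such that for every Q ∈ (𝒬_{k*+1} \ 𝒬_{k*}) ∪ ℋ^u_{k*+1} there exists M ∈ cone(𝒬_{k*} ∪ ℋ^l_{k*}) with Q ⪯ M, and consequently O_k = O_{k*} for all k ≥ k*, so that the maximal constraint-admissible invariant set O_∞ := ∩_{k ∈ ℕ} O_k equals O_{k*}. -/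

import Mathlib

open Matrix

/-- The cone (set of nonnegative linear combinations) generated by a set of matrices. -/
def matCone {α : Type*} [AddCommMonoid α] [Module ℝ α] (S : Set α) : Set α :=
  { M | ∃ (t : Finset α) (c : α → ℝ), (↑t : Set α) ⊆ S ∧ (∀ x ∈ t, 0 ≤ c x) ∧
      M = ∑ x ∈ t, c x • x }

section

open Filter Topology

theorem eventually_posSemidef_smul_one_add {ι : Type*} [Fintype ι] [DecidableEq ι] {c : ℝ}
    (hc : 0 < c) {T : ℕ → Matrix ι ι ℝ} (hT : Tendsto T atTop (𝓝 0))
    (hsymm : ∀ k, (T k).IsHermitian) :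
    ∀ᶠ k in atTop, (c • (1 : Matrix ι ι ℝ) + T k).PosSemidef := by
  obtain ⟨ε, hε, hεc⟩ : ∃ ε : ℝ, 0 < ε ∧ ε * Fintype.card ι ≤ c :=
    ⟨c / (Fintype.card ι + 1), by positivity, by
      rw [div_mul_eq_mul_div, div_le_iff₀ (by positivity)]
      nlinarith⟩
  have hentry : ∀ i j, ∀ᶠ k in atTop, |T k i j| < ε := fun i j => by
    have h : Tendsto (fun k => T k i j) atTop (𝓝 0) :=
      ((continuous_id.matrix_elem i j).tendsto (0 : Matrix ι ι ℝ)).comp hT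
    have h' := h.abs
    rw [abs_zero] at h'
    exact h'.eventually_lt_const hε
  filter_upwards [eventually_all.2 fun i => eventually_all.2 fun j => hentry i j] with k hk
  refine .of_dotProduct_mulVec_nonneg ?_ fun x => ?_
  · exact (isHermitian_one.smul (by simp [IsSelfAdjoint])).add (hsymm k)
  · have hbound : -(ε * ∑ i, ∑ j, (x i ^ 2 + x j ^ 2) / 2) ≤ x ⬝ᵥ (T k *ᵥ x) := by
      simp only [dotProduct, mulVec, Finset.mul_sum, ← Finset.sum_neg_distrib]
      refine Finset.sum_le_sum fun i _ => Finset.sum_le_sum fun j _ => ?_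
      have h1 : |x i * (T k i j * x j)| ≤ ε * |x i * x j| := by
        rw [show x i * (T k i j * x j) = T k i j * (x i * x j) by ring, abs_mul]
        exact mul_le_mul_of_nonneg_right (hk i j).le (abs_nonneg _)
      have h2 : |x i * x j| ≤ (x i ^ 2 + x j ^ 2) / 2 :=
        abs_le.2 ⟨by nlinarith [sq_nonneg (x i + x j)], by nlinarith [sq_nonneg (x i - x j)]⟩
      exact (abs_le.1 (h1.trans (mul_le_mul_of_nonneg_left h2 hε.le))).1
    have hsum : ∑ i, ∑ j, (x i ^ 2 + x j ^ 2) / 2 = Fintype.card ι * (x ⬝ᵥ x) := by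
      simp only [← Finset.sum_div, Finset.sum_add_distrib, Finset.sum_const, Finset.card_univ,
        nsmul_eq_mul, ← Finset.mul_sum, dotProduct, ← pow_two]
      ring
    rw [hsum] at hbound
    have hnn : 0 ≤ x ⬝ᵥ x := Finset.sum_nonneg fun i _ => mul_self_nonneg _
    simp only [star_trivial, add_mulVec, smul_mulVec, one_mulVec, dotProduct_add, dotProduct_smul,
      smul_eq_mul]
    nlinarith [mul_le_mul_of_nonneg_right hεc hnn]

/-- The homogenization of the quadratic function `x ↦ xᵀ R x + 2 rᵀ x - 1`. -/
def homogenization {ι : Type*} (R : Matrix ι ι ℝ) (r : ι → ℝ) :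
    Matrix (ι ⊕ Unit) (ι ⊕ Unit) ℝ :=
  fromBlocks R (of fun i _ => r i) (of fun _ j => r j) (of fun _ _ => -1)

theorem dotProduct_homogenization_mulVec {ι : Type*} [Fintype ι] (R : Matrix ι ι ℝ) (r x : ι → ℝ) :
    Sum.elim x (1 : Unit → ℝ) ⬝ᵥ (homogenization R r *ᵥ Sum.elim x 1) =
      x ⬝ᵥ (R *ᵥ x) + 2 * (r ⬝ᵥ x) - 1 := by
  have h1 : (of fun (i : ι) (_ : Unit) => r i) *ᵥ (1 : Unit → ℝ) = r := by
    ext i; simp [mulVec, dotProduct]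
  have h2 : (of fun (_ : Unit) (j : ι) => r j) *ᵥ x = fun _ => r ⬝ᵥ x := by
    ext i; simp [mulVec]
  have h3 : (of fun (_ _ : Unit) => (-1 : ℝ)) *ᵥ (1 : Unit → ℝ) = fun _ => -1 := by
    ext i; simp [mulVec, dotProduct]
  rw [homogenization, fromBlocks_mulVec]
  simp only [Sum.elim_comp_inl, Sum.elim_comp_inr, sumElim_dotProduct_sumElim, h1, h2, h3,
    dotProduct_add, dotProduct_comm x r]
  simp [dotProduct]
  ring

theorem isHermitian_homogenization {ι : Type*} {R : Matrix ι ι ℝ} (hR : Rᵀ = R) (r : ι → ℝ) :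
    (homogenization R r).IsHermitian :=
  IsHermitian.fromBlocks (by rw [IsHermitian, conjTranspose_eq_transpose_of_trivial, hR])
    (by ext; simp) (by ext; simp)

theorem eventually_posSemidef_homogenization {ι : Type*} [Fintype ι] [DecidableEq ι]
    {A : Matrix ι ι ℝ} (hA : Tendsto (fun k : ℕ => A ^ k) atTop (𝓝 0)) {D : ℝ} (hD : 0 < D)
    {R : Matrix ι ι ℝ} (hR : Rᵀ = R) (r : ι → ℝ) :
    ∀ᶠ k : ℕ in atTop, ((1 / 2 : ℝ) • homogenization ((1 / D) • (1 : Matrix ι ι ℝ)) 0 -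
      (fromBlocks A 0 0 (1 : Matrix Unit Unit ℝ) ^ k)ᵀ * homogenization R r *
        fromBlocks A 0 0 (1 : Matrix Unit Unit ℝ) ^ k).PosSemidef := by
  set c : ℝ := min (1 / (2 * D)) (1 / 2)
  have hc0 : 0 < c := lt_min (by positivity) (by norm_num)
  set N := homogenization R r with hN
  set E : Matrix (ι ⊕ Unit) (ι ⊕ Unit) ℝ := fromBlocks 0 0 0 1 with hE
  set P : ℕ → Matrix (ι ⊕ Unit) (ι ⊕ Unit) ℝ := fun k => fromBlocks A 0 0 1 ^ k with hP
  have hPE : Tendsto P atTop (𝓝 E) := by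
    have hcont : Continuous fun B : Matrix ι ι ℝ => fromBlocks B 0 0 (1 : Matrix Unit Unit ℝ) :=
      continuous_id.matrix_fromBlocks continuous_const continuous_const continuous_const
    simpa only [hP, fromBlocks_diagonal_pow, one_pow, Function.comp_def] using
      (hcont.tendsto 0).comp hA
  have hT : Tendsto (fun k => Eᵀ * N * E - (P k)ᵀ * N * P k) atTop (𝓝 0) := by
    have hcont : Continuous fun B : Matrix (ι ⊕ Unit) (ι ⊕ Unit) ℝ =>
        Eᵀ * N * E - Bᵀ * N * B := by fun_prop
    simpa only [sub_self, Function.comp_def] using (hcont.tendsto E).comp hPE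
  have hherm : ∀ B : Matrix (ι ⊕ Unit) (ι ⊕ Unit) ℝ, (Bᵀ * N * B).IsHermitian := fun B => by
    simpa only [conjTranspose_eq_transpose_of_trivial] using
      isHermitian_conjTranspose_mul_mul B (isHermitian_homogenization hR r)
  have hdiag : (1 / 2 : ℝ) • homogenization ((1 / D) • (1 : Matrix ι ι ℝ)) 0 - Eᵀ * N * E =
      diagonal (Sum.elim (fun _ => 1 / (2 * D)) fun _ => 1 / 2) := by
    rw [hE, hN, homogenization, homogenization, fromBlocks_transpose, fromBlocks_multiply,
      fromBlocks_multiply, fromBlocks_smul]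
    ext (i | i) (j | j)
    · simp [Matrix.one_apply, diagonal_apply, mul_comm]
    · simp
    · simp
    · simp
      norm_num
  have hdom : (diagonal (Sum.elim (fun _ => 1 / (2 * D)) fun _ => 1 / 2) -
      c • (1 : Matrix (ι ⊕ Unit) (ι ⊕ Unit) ℝ)).PosSemidef := by
    rw [smul_one_eq_diagonal, diagonal_sub]
    refine PosSemidef.diagonal ?_
    rintro (i | i)
    · exact sub_nonneg.2 (min_le_left _ _)
    · exact sub_nonneg.2 (min_le_right _ _)
  filter_upwards [eventually_posSemidef_smul_one_add hc0 hT
    fun k => (hherm E).sub (hherm (P k))] with k hk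
  convert hdom.add hk using 1
  rw [← hdiag]
  abel

theorem quadratic_le_one_of_posSemidef {ι : Type*} [Fintype ι] [DecidableEq ι]
    {A : Matrix ι ι ℝ} {D : ℝ} {R : Matrix ι ι ℝ} {r : ι → ℝ} {k : ℕ}
    (h : ((1 / 2 : ℝ) • homogenization ((1 / D) • (1 : Matrix ι ι ℝ)) 0 -
      (fromBlocks A 0 0 (1 : Matrix Unit Unit ℝ) ^ k)ᵀ * homogenization R r *
        fromBlocks A 0 0 (1 : Matrix Unit Unit ℝ) ^ k).PosSemidef)
    {x : ι → ℝ} (hx : x ⬝ᵥ (((1 / D) • (1 : Matrix ι ι ℝ)) *ᵥ x) ≤ 1) :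
    (A ^ k *ᵥ x) ⬝ᵥ (R *ᵥ (A ^ k *ᵥ x)) + 2 * (r ⬝ᵥ (A ^ k *ᵥ x)) ≤ 1 := by
  have hP : fromBlocks A 0 0 (1 : Matrix Unit Unit ℝ) ^ k *ᵥ Sum.elim x 1 =
      Sum.elim (A ^ k *ᵥ x) 1 := by
    simp [fromBlocks_diagonal_pow, fromBlocks_mulVec]
  have h0 := h.dotProduct_mulVec_nonneg (Sum.elim x 1)
  rw [star_trivial, sub_mulVec, dotProduct_sub, smul_mulVec, dotProduct_smul,
    dotProduct_homogenization_mulVec, ← mulVec_mulVec, ← mulVec_mulVec, hP,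
    dotProduct_mulVec _ (transpose _),
    vecMul_transpose, hP, dotProduct_homogenization_mulVec, zero_dotProduct, smul_eq_mul] at h0
  linarith

theorem mem_iff_forall_mem_of_inter_preimage {ι : Type*} [Fintype ι] [DecidableEq ι]
    {A : Matrix ι ι ℝ} {O : ℕ → Set (ι → ℝ)}
    (hO : ∀ k, O (k + 1) = O k ∩ {x | A *ᵥ x ∈ O k}) (k : ℕ) (x : ι → ℝ) :
    x ∈ O k ↔ ∀ j ≤ k, A ^ j *ᵥ x ∈ O 0 := by
  induction k generalizing x with
  | zero => simp
  | succ k ih =>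
    rw [hO, Set.mem_inter_iff, Set.mem_ofPred_eq, ih, ih]
    simp only [mulVec_mulVec, ← pow_succ]
    constructor
    · rintro ⟨h1, h2⟩ j hj
      rcases hj.lt_or_eq with h | rfl
      · exact h1 j (by omega)
      · exact h2 k le_rfl
    · exact fun h => ⟨fun j hj => h j (by omega), fun j hj => h (j + 1) (by omega)⟩

theorem exists_eq_conj_pow_of_mem_diff {ι κ : Type*} [Fintype κ] [DecidableEq κ]
    {P : Matrix κ κ ℝ} {N : ι → Matrix κ κ ℝ} {S : ℕ → Set (Matrix κ κ ℝ)}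
    (h0 : S 0 = Set.range N) (hS : ∀ k, S (k + 1) = S k ∪ (fun M => Pᵀ * M * P) '' S k)
    (k : ℕ) {M : Matrix κ κ ℝ} (hM : M ∈ S (k + 1) \ S k) :
    ∃ i, M = (P ^ (k + 1))ᵀ * N i * P ^ (k + 1) := by
  induction k generalizing M with
  | zero =>
    obtain ⟨hM, hM'⟩ := hM
    rw [hS] at hM
    obtain ⟨M', hM1, rfl⟩ := hM.resolve_left hM'
    rw [h0] at hM1
    obtain ⟨i, rfl⟩ := hM1
    exact ⟨i, by simp⟩
  | succ k ih =>
    obtain ⟨hM, hM'⟩ := hM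
    rw [hS] at hM
    obtain ⟨M', hM1, rfl⟩ := hM.resolve_left hM'
    obtain ⟨i, rfl⟩ := ih ⟨hM1, fun h => hM' (by rw [hS]; exact .inr ⟨M', h, rfl⟩)⟩
    exact ⟨i, by simp only [pow_succ _ (k + 1), transpose_mul, Matrix.mul_assoc]⟩

theorem exists_eq_conj_pow_of_mem {ι κ : Type*} [Fintype κ] [DecidableEq κ]
    {P : Matrix κ κ ℝ} {N : ι → Matrix κ κ ℝ} {S : ℕ → Set (Matrix κ κ ℝ)}
    (h0 : S 0 = Set.range N) (hS : ∀ k, S (k + 1) = (fun M => Pᵀ * M * P) '' S k)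
    (k : ℕ) {M : Matrix κ κ ℝ} (hM : M ∈ S k) :
    ∃ i, M = (P ^ k)ᵀ * N i * P ^ k := by
  induction k generalizing M with
  | zero =>
    rw [h0] at hM
    obtain ⟨i, rfl⟩ := hM
    exact ⟨i, by simp⟩
  | succ k ih =>
    rw [hS] at hM
    obtain ⟨M', hM1, rfl⟩ := hM
    obtain ⟨i, rfl⟩ := ih hM1
    exact ⟨i, by simp only [pow_succ, transpose_mul, Matrix.mul_assoc]⟩

theorem smul_mem_matCone {α : Type*} [AddCommMonoid α] [Module ℝ α] {S : Set α} {x : α}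
    (hx : x ∈ S) {c : ℝ} (hc : 0 ≤ c) : c • x ∈ matCone S :=
  ⟨{x}, fun _ => c, by simpa using hx, fun _ _ => hc, by simp⟩

end

/-- Finite determination with nonlinear constraints: under Schur stability of A,
compactness of Ω with 0 in its interior, globally valid two-sided quadratic bounds for
the H_i, and the redundant ball constraint Q_1 = (1/D_x)I, q_1 = 0, there exists a finite
k* such that every Q ∈ (𝒬_{k*+1} \ 𝒬_{k*}) ∪ ℋ^u_{k*+1} is dominated by an element of
cone(𝒬_{k*} ∪ ℋ^l_{k*}); consequently O_k = O_{k*} for all k ≥ k* and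
O_∞ := ⋂_k O_k equals O_{k*}. -/
theorem finite_determination_nonlinear (n p m : ℕ) (hp : 0 < p)
    (A : Matrix (Fin n) (Fin n) ℝ)
    (hA : Filter.Tendsto (fun k : ℕ => A ^ k) Filter.atTop (nhds 0))
    (Q : Fin p → Matrix (Fin n) (Fin n) ℝ) (q : Fin p → Fin n → ℝ)
    (hQsymm : ∀ i, (Q i)ᵀ = Q i)
    (Ω : Set (Fin n → ℝ))
    (hΩ : Ω = {x : Fin n → ℝ | ∀ i : Fin p, x ⬝ᵥ (Q i).mulVec x + 2 * (q i ⬝ᵥ x) ≤ 1})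
    (hΩcompact : IsCompact Ω) (hΩint : (0 : Fin n → ℝ) ∈ interior Ω)
    (Dx : ℝ) (hDx : 0 < Dx)
    (hQ1 : Q ⟨0, hp⟩ = (1 / Dx) • (1 : Matrix (Fin n) (Fin n) ℝ))
    (hq1 : q ⟨0, hp⟩ = 0)
    (H : Fin m → (Fin n → ℝ) → ℝ)
    (hHcont : ∀ i, Continuous (H i)) (hH0 : ∀ i, H i 0 = 0)
    (G : Fin m → Fin n → ℝ) (L : Fin m → ℝ) (hL : ∀ i, 0 ≤ L i)
    (hquasi : ∀ i : Fin m, ∀ x : Fin n → ℝ,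
      |H i x - H i 0 - G i ⬝ᵥ x| ≤ L i / 2 * (x ⬝ᵥ x))
    (Θ : Set (Fin n → ℝ)) (hΘ : Θ = {x : Fin n → ℝ | ∀ i : Fin m, H i x ≤ 1})
    (X : Set (Fin n → ℝ)) (hX : X = Ω ∩ Θ)
    (O : ℕ → Set (Fin n → ℝ)) (hO0 : O 0 = X)
    (hOsucc : ∀ k : ℕ, O (k + 1) = O k ∩ {x : Fin n → ℝ | A.mulVec x ∈ O k})
    (Abar : Matrix (Fin n ⊕ Unit) (Fin n ⊕ Unit) ℝ)
    (hAbar : Abar = Matrix.fromBlocks A 0 0 1)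
    (Qbar : Fin p → Matrix (Fin n ⊕ Unit) (Fin n ⊕ Unit) ℝ)
    (hQbar : ∀ i, Qbar i = Matrix.fromBlocks (Q i) (Matrix.of fun r (_ : Unit) => q i r)
      (Matrix.of fun (_ : Unit) c => q i c) (Matrix.of fun (_ : Unit) (_ : Unit) => (-1 : ℝ)))
    (Hubar : Fin m → Matrix (Fin n ⊕ Unit) (Fin n ⊕ Unit) ℝ)
    (hHubar : ∀ i, Hubar i = Matrix.fromBlocks ((L i / 2) • (1 : Matrix (Fin n) (Fin n) ℝ))
      (Matrix.of fun r (_ : Unit) => G i r / 2)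
      (Matrix.of fun (_ : Unit) c => G i c / 2)
      (Matrix.of fun (_ : Unit) (_ : Unit) => H i 0 - 1))
    (Hlbar : Fin m → Matrix (Fin n ⊕ Unit) (Fin n ⊕ Unit) ℝ)
    (hHlbar : ∀ i, Hlbar i = Matrix.fromBlocks (-(L i / 2) • (1 : Matrix (Fin n) (Fin n) ℝ))
      (Matrix.of fun r (_ : Unit) => G i r / 2)
      (Matrix.of fun (_ : Unit) c => G i c / 2)
      (Matrix.of fun (_ : Unit) (_ : Unit) => H i 0 - 1))
    (𝒬 : ℕ → Set (Matrix (Fin n ⊕ Unit) (Fin n ⊕ Unit) ℝ))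
    (h𝒬0 : 𝒬 0 = Set.range Qbar)
    (h𝒬succ : ∀ k : ℕ, 𝒬 (k + 1) = 𝒬 k ∪ (fun M => Abarᵀ * M * Abar) '' 𝒬 k)
    (ℋu : ℕ → Set (Matrix (Fin n ⊕ Unit) (Fin n ⊕ Unit) ℝ))
    (hℋu0 : ℋu 0 = Set.range Hubar)
    (hℋusucc : ∀ k : ℕ, ℋu (k + 1) = (fun M => Abarᵀ * M * Abar) '' ℋu k)
    (ℋl : ℕ → Set (Matrix (Fin n ⊕ Unit) (Fin n ⊕ Unit) ℝ))
    (hℋl0 : ℋl 0 = Set.range Hlbar)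
    (hℋlsucc : ∀ k : ℕ, ℋl (k + 1) = ℋl k ∪ (fun M => Abarᵀ * M * Abar) '' ℋl k) :
    ∃ kstar : ℕ,
      (∀ Q' ∈ (𝒬 (kstar + 1) \ 𝒬 kstar) ∪ ℋu (kstar + 1),
        ∃ M ∈ matCone (𝒬 kstar ∪ ℋl kstar), (M - Q').PosSemidef) ∧
      (∀ k : ℕ, kstar ≤ k → O k = O kstar) ∧
      (⋂ k : ℕ, O k) = O kstar := by
  have hQbar' : ∀ i, Qbar i = homogenization (Q i) (q i) := hQbar
  have hHubar' : ∀ i, Hubar i =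
      homogenization ((L i / 2) • (1 : Matrix (Fin n) (Fin n) ℝ)) fun j => G i j / 2 := fun i => by
    rw [hHubar, homogenization, hH0, zero_sub]
  have hevQ := Filter.eventually_all.2 fun i =>
    eventually_posSemidef_homogenization hA hDx (hQsymm i) (q i)
  have hevH := Filter.eventually_all.2 fun i : Fin m =>
    eventually_posSemidef_homogenization hA hDx
      (R := (L i / 2) • (1 : Matrix (Fin n) (Fin n) ℝ)) (by simp) fun j => G i j / 2
  obtain ⟨K, hK⟩ := Filter.eventually_atTop.1 (hevQ.and hevH)
  have hball : Qbar ⟨0, hp⟩ = homogenization ((1 / Dx) • (1 : Matrix (Fin n) (Fin n) ℝ)) 0 := by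
    rw [hQbar', hQ1, hq1]
  have hmem𝒬 : ∀ k, Qbar ⟨0, hp⟩ ∈ 𝒬 k := fun k => by
    induction k with
    | zero => exact h𝒬0 ▸ Set.mem_range_self _
    | succ k ih => exact h𝒬succ k ▸ .inl ih
  have hmemO := mem_iff_forall_mem_of_inter_preimage hOsucc
  have hpow : ∀ x ∈ X, ∀ k, K ≤ k → A ^ k *ᵥ x ∈ X := by
    intro x hx k hk
    have hxball : x ⬝ᵥ (((1 / Dx) • (1 : Matrix (Fin n) (Fin n) ℝ)) *ᵥ x) ≤ 1 := by
      rw [hX, hΩ] at hx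
      simpa [hQ1, hq1] using hx.1 ⟨0, hp⟩
    rw [hX, hΩ, hΘ]
    refine ⟨fun i => quadratic_le_one_of_posSemidef ((hK k hk).1 i) hxball, fun i => ?_⟩
    have h1 := quadratic_le_one_of_posSemidef ((hK k hk).2 i) hxball
    have h2 := (abs_le.1 (hquasi i (A ^ k *ᵥ x))).2
    have h3 : 2 * ((fun j => G i j / 2) ⬝ᵥ (A ^ k *ᵥ x)) = G i ⬝ᵥ (A ^ k *ᵥ x) := by
      simp only [dotProduct, Finset.mul_sum]
      exact Finset.sum_congr rfl fun j _ => by ring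
    rw [smul_mulVec, one_mulVec, dotProduct_smul, smul_eq_mul, h3] at h1
    rw [hH0] at h2
    linarith
  have hmono : ∀ k l, k ≤ l → O l ⊆ O k := fun k l hkl x hx =>
    (hmemO k x).2 fun j hj => (hmemO l x).1 hx j (hj.trans hkl)
  have hstab : ∀ k, O K ⊆ O k := fun k x hx => (hmemO k x).2 fun j _ => by
    have hx' := (hmemO K x).1 hx
    rcases le_total j K with h | h
    · exact hx' j h
    · rw [hO0] at hx' ⊢
      exact hpow x (by simpa using hx' 0 (Nat.zero_le K)) j h
  refine ⟨K, fun Q' hQ' => ⟨(1 / 2 : ℝ) • Qbar ⟨0, hp⟩,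
    smul_mem_matCone (.inl (hmem𝒬 K)) (by norm_num), ?_⟩,
    fun k hk => (hmono K k hk).antisymm (hstab k),
    (Set.iInter_subset O K).antisymm (Set.subset_iInter hstab)⟩
  obtain ⟨hKQ, hKH⟩ := hK (K + 1) (Nat.le_succ K)
  rcases hQ' with hQ' | hQ'
  · obtain ⟨i, rfl⟩ := exists_eq_conj_pow_of_mem_diff h𝒬0 h𝒬succ K hQ'
    rw [hball, hQbar', hAbar]
    exact hKQ i
  · obtain ⟨i, rfl⟩ := exists_eq_conj_pow_of_mem hℋu0 hℋusucc (K + 1) hQ'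
    rw [hball, hHubar', hAbar]
    exact hKH i
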